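/- arXiv:1609.01677 — 2 statements merged into one kernel-verified Lean document; each statement's English description precedes it below -/
import Mathlib

section
/- Let G be a finite simple graph on n vertices. Then the sum over all unordered pairs {x,y} of distinct vertices of 1/(δ(x,y)+1) is at most n·hom(G). -/
open Finset
open scoped Classical

/-- The number of distinct vertex degrees in the subgraph of `G` induced by `s`. -/
noncomputable def distinctDegrees {V : Type*} (G : SimpleGraph V) (s : Finset V) : ℕ :=
  (s.image fun x => (s.filter fun y => G.Adj x y).card).card

/-- `f(G)`: the largest number of distinct degrees in an induced subgraph of `G`. -/
noncomputable def fNumber {V : Type*} [Fintype V] (G : SimpleGraph V) : ℕ :=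
  sSup {m : ℕ | ∃ s : Finset V, distinctDegrees G s = m}

/-- `hom(G)`: the size of the largest clique or independent set of `G`. -/
noncomputable def homNumber {V : Type*} (G : SimpleGraph V) : ℕ :=
  sSup {n : ℕ | ∃ s : Finset V, (G.IsClique ↑s ∨ Gᶜ.IsClique ↑s) ∧ s.card = n}

/-- The neighbourhood-distance `δ(x,y) = |(Γ(x)\{y}) △ (Γ(y)\{x})|`. -/
noncomputable def nbhdDist {V : Type*} [Fintype V] (G : SimpleGraph V) (x y : V) : ℕ :=
  (symmDiff ((G.neighborFinset x).erase y) ((G.neighborFinset y).erase x)).card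

theorem card_le_homNumber {V : Type*} [Fintype V] (G : SimpleGraph V) (s : Finset V)
    (hs : G.IsClique ↑s ∨ Gᶜ.IsClique ↑s) : s.card ≤ homNumber G := by
  refine le_csSup ⟨Fintype.card V, ?_⟩ ⟨s, hs, rfl⟩
  rintro _ ⟨t, -, rfl⟩
  exact t.card_le_univ

/-- A uniformly random permutation attains its minimum on `s` at a given element of `s` with
probability at least `1 / s.card`. -/
theorem card_perm_le_card_mul_card_min {V : Type*} [Fintype V] [LinearOrder V]
    (s : Finset V) (y : V) (hy : y ∈ s) :
    Fintype.card (Equiv.Perm V) ≤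
      s.card * (univ.filter fun σ : Equiv.Perm V => ∀ z ∈ s, σ y ≤ σ z).card := by
  have hcover : (univ : Finset (Equiv.Perm V)) ⊆
      s.biUnion fun w => univ.filter fun σ : Equiv.Perm V => ∀ z ∈ s, σ w ≤ σ z := by
    intro σ _
    obtain ⟨w, hw, hmin⟩ := s.exists_min_image σ ⟨y, hy⟩
    simp only [mem_biUnion, mem_filter, mem_univ, true_and]
    exact ⟨w, hw, hmin⟩
  refine (card_le_card hcover).trans (card_biUnion_le_card_mul _ _ _ fun w hw => ?_)
  refine card_le_card_of_injOn (fun σ => σ * Equiv.swap w y) ?_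
    (mul_left_injective (Equiv.swap w y)).injOn
  intro σ hσ
  simp only [coe_filter, mem_univ, true_and, Set.mem_ofPred_eq] at hσ ⊢
  intro z hz
  simp only [Equiv.Perm.mul_apply, Equiv.swap_apply_right]
  apply hσ
  by_cases h1 : z = w
  · simpa [h1] using hy
  by_cases h2 : z = y
  · simpa [h2] using hw
  rwa [Equiv.swap_apply_of_ne_of_ne h1 h2]

/-- The vertices `y ≠ x` that `σ` places before every vertex distinguishing `x` from `y`. -/
noncomputable def searchPath {V : Type*} [Fintype V] [LinearOrder V] (G : SimpleGraph V)
    (σ : Equiv.Perm V) (x : V) : Finset V :=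
  univ.filter fun y => y ≠ x ∧
    ∀ z ∈ symmDiff ((G.neighborFinset x).erase y) ((G.neighborFinset y).erase x), σ y ≤ σ z

theorem adj_iff_of_mem_searchPath {V : Type*} [Fintype V] [LinearOrder V] (G : SimpleGraph V)
    (σ : Equiv.Perm V) {x y z : V} (hy : y ∈ searchPath G σ x) (hz : z ∈ searchPath G σ x)
    (hlt : σ z < σ y) : G.Adj x z ↔ G.Adj y z := by
  simp only [searchPath, mem_filter, mem_univ, true_and] at hy hz
  have hzy : z ≠ y := fun h => hlt.ne (congrArg σ h)
  have hnot := fun h => (hy.2 z h).not_gt hlt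
  simp only [mem_symmDiff, mem_erase, SimpleGraph.mem_neighborFinset] at hnot
  have hzx := hz.1
  tauto

theorem card_searchPath_le {V : Type*} [Fintype V] [LinearOrder V] (G : SimpleGraph V)
    (σ : Equiv.Perm V) (x : V) : (searchPath G σ x).card ≤ 2 * homNumber G := by
  have hadj : ∀ y ∈ searchPath G σ x, ∀ z ∈ searchPath G σ x, y ≠ z →
      (G.Adj x y ↔ G.Adj x z) → (G.Adj y z ↔ G.Adj x z) := by
    intro y hy z hz hne hiff
    rcases lt_or_gt_of_ne (σ.injective.ne hne) with h | h
    · rw [← hiff, adj_iff_of_mem_searchPath G σ hz hy h, G.adj_comm]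
    · rw [adj_iff_of_mem_searchPath G σ hy hz h]
  rw [← card_filter_add_card_filter_not (s := searchPath G σ x) (fun y => G.Adj x y), two_mul]
  refine add_le_add (card_le_homNumber G _ (Or.inl ?_)) (card_le_homNumber G _ (Or.inr ?_))
  · intro y hy z hz hne
    simp only [coe_filter, Set.mem_ofPred_eq] at hy hz
    exact (hadj y hy.1 z hz.1 hne (iff_of_true hy.2 hz.2)).mpr hz.2
  · intro y hy z hz hne
    simp only [coe_filter, Set.mem_ofPred_eq] at hy hz
    exact ⟨hne, fun h => hz.2 ((hadj y hy.1 z hz.1 hne (iff_of_false hy.2 hz.2)).mp h)⟩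

theorem card_perm_div_le_card_mem_searchPath {V : Type*} [Fintype V] [LinearOrder V]
    (G : SimpleGraph V) {x y : V} (hxy : x ≠ y) :
    (Fintype.card (Equiv.Perm V) : ℝ) * (1 / ((nbhdDist G x y : ℝ) + 1)) ≤
      ((univ.filter fun σ : Equiv.Perm V => y ∈ searchPath G σ x).card : ℝ) := by
  set D := symmDiff ((G.neighborFinset x).erase y) ((G.neighborFinset y).erase x) with hD
  have hcard : (insert y D).card ≤ nbhdDist G x y + 1 := by
    refine (card_insert_le _ _).trans_eq ?_
    rw [nbhdDist, hD]
    congr!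
  have hsub : (univ.filter fun σ : Equiv.Perm V => ∀ z ∈ insert y D, σ y ≤ σ z).card ≤
      (univ.filter fun σ : Equiv.Perm V => y ∈ searchPath G σ x).card := by
    refine card_le_card fun σ hσ => ?_
    simp only [searchPath, mem_filter, mem_univ, true_and] at hσ ⊢
    exact ⟨hxy.symm, fun z hz => hσ z (mem_insert_of_mem hz)⟩
  have h := (card_perm_le_card_mul_card_min (insert y D) y (mem_insert_self _ _)).trans
    (Nat.mul_le_mul hcard hsub)
  rw [mul_one_div, div_le_iff₀ (by positivity), mul_comm]
  exact_mod_cast h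

/-- The sum over all unordered pairs `{x,y}` of distinct vertices of `1/(δ(x,y)+1)` is at most
`n·hom(G)`.  (Since `δ` is symmetric, this sum equals half the sum over ordered pairs.) -/
theorem stmt_9 (n : ℕ) (G : SimpleGraph (Fin n)) :
    (∑ p ∈ Finset.univ.offDiag, (1 : ℝ) / ((nbhdDist G p.1 p.2 : ℝ) + 1)) / 2 ≤
      (n : ℝ) * (homNumber G : ℝ) := by
  set N : ℝ := (Fintype.card (Equiv.Perm (Fin n)) : ℝ) with hN
  have hNpos : 0 < N := by
    rw [hN]
    exact_mod_cast Fintype.card_pos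
  suffices h : N * ∑ p ∈ (univ : Finset (Fin n)).offDiag,
      (1 : ℝ) / ((nbhdDist G p.1 p.2 : ℝ) + 1) ≤ N * (2 * (n * homNumber G)) by
    linarith [le_of_mul_le_mul_left h hNpos]
  calc
    _ = ∑ p ∈ (univ : Finset (Fin n)).offDiag,
          N * ((1 : ℝ) / ((nbhdDist G p.1 p.2 : ℝ) + 1)) := mul_sum _ _ _
    _ ≤ ∑ p ∈ (univ : Finset (Fin n)).offDiag,
          ((univ.filter fun σ : Equiv.Perm (Fin n) => p.2 ∈ searchPath G σ p.1).card : ℝ) :=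
      sum_le_sum fun p hp => card_perm_div_le_card_mem_searchPath G (mem_offDiag.mp hp).2.2
    _ ≤ ∑ p : Fin n × Fin n,
          ((univ.filter fun σ : Equiv.Perm (Fin n) => p.2 ∈ searchPath G σ p.1).card : ℝ) :=
      sum_le_sum_of_subset_of_nonneg (subset_univ _) fun _ _ _ => Nat.cast_nonneg _
    _ = ∑ x : Fin n, ∑ σ : Equiv.Perm (Fin n), ((searchPath G σ x).card : ℝ) := by
      rw [Fintype.sum_prod_type]
      refine sum_congr rfl fun x _ => ?_
      have := sum_card_bipartiteAbove_eq_sum_card_bipartiteBelow (s := univ) (t := univ)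
        fun (y : Fin n) (σ : Equiv.Perm (Fin n)) => y ∈ searchPath G σ x
      simp only [bipartiteAbove, bipartiteBelow, filter_univ_mem] at this
      exact_mod_cast this
    _ ≤ ∑ _x : Fin n, ∑ _σ : Equiv.Perm (Fin n), (2 * homNumber G : ℝ) :=
      sum_le_sum fun x _ => sum_le_sum fun σ _ => by exact_mod_cast card_searchPath_le G σ x
    _ = N * (2 * (n * homNumber G)) := by
      simp only [sum_const, card_univ, nsmul_eq_mul, Fintype.card_fin, ← hN]
      ring
end

section
/- Let k be a positive integer and let G be a finite simple graph with f(G) < k. Then for every nonempty subset W of the vertices of G, Σ_{{x,y} ⊆ W} 5/√(δ(x,y)+1) > (|W|² - 3k|W|)/(54k), where the sum ranges over all unordered pairs {x,y} of distinct vertices in W. -/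
open Finset
open scoped Classical

theorem centralBinom_sq_mul_le (n : ℕ) : n.centralBinom ^ 2 * (2 * n + 1) ≤ 16 ^ n := by
  induction n with
  | zero => simp
  | succ n ih =>
    have h := Nat.succ_mul_centralBinom_succ n
    have h2 : (n + 1) ^ 2 * ((n + 1).centralBinom ^ 2 * (2 * (n + 1) + 1)) ≤
        (n + 1) ^ 2 * 16 ^ (n + 1) := by
      calc (n + 1) ^ 2 * ((n + 1).centralBinom ^ 2 * (2 * (n + 1) + 1))
          = ((n + 1) * (n + 1).centralBinom) ^ 2 * (2 * n + 3) := by ring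
        _ = (n.centralBinom ^ 2 * (2 * n + 1)) * (4 * ((2 * n + 1) * (2 * n + 3))) := by
            rw [h]; ring
        _ ≤ 16 ^ n * (4 * (4 * (n + 1) ^ 2)) :=
            Nat.mul_le_mul ih (Nat.mul_le_mul_left 4 (by nlinarith))
        _ = (n + 1) ^ 2 * 16 ^ (n + 1) := by ring
    exact Nat.le_of_mul_le_mul_left h2 (by positivity)

theorem choose_sq_mul_succ_le (d b : ℕ) : d.choose b ^ 2 * (d + 1) ≤ 4 ^ d := by
  have hb : d.choose b ^ 2 * (d + 1) ≤ d.choose (d / 2) ^ 2 * (d + 1) := by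
    gcongr
    exact Nat.choose_le_middle b d
  refine hb.trans ?_
  rcases Nat.even_or_odd' d with ⟨n, rfl | rfl⟩
  · have h := centralBinom_sq_mul_le n
    rw [Nat.centralBinom_eq_two_mul_choose] at h
    rw [show 2 * n / 2 = n by omega, pow_mul]
    exact h
  · have h := centralBinom_sq_mul_le (n + 1)
    rw [Nat.centralBinom_eq_two_mul_choose, show 2 * (n + 1) = 2 * n + 1 + 1 by ring,
      Nat.choose_succ_succ, Nat.choose_symm_half] at h
    have h16 : 4 ^ (2 * n + 1) * 4 = 16 ^ (n + 1) := by
      rw [← pow_succ, show 2 * n + 1 + 1 = 2 * (n + 1) by ring, pow_mul]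
      norm_num
    rw [show (2 * n + 1) / 2 = n by omega]
    nlinarith [sq_nonneg ((2 * n + 1).choose n)]

theorem choose_le_two_pow_div_sqrt (d b : ℕ) :
    (d.choose b : ℝ) ≤ 2 ^ d / Real.sqrt ((d : ℝ) + 1) := by
  have hs : 0 < Real.sqrt ((d : ℝ) + 1) := Real.sqrt_pos.mpr (by positivity)
  rw [le_div_iff₀ hs]
  refine le_of_sq_le_sq ?_ (by positivity)
  rw [mul_pow, Real.sq_sqrt (by positivity), ← pow_mul, mul_comm d 2, pow_mul]
  norm_num
  exact_mod_cast choose_sq_mul_succ_le d b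

/-- The number of sets meeting two disjoint sets `A` and `B` equally often. -/
theorem card_filter_card_inter_eq_le {V : Type*} [Fintype V] (A B : Finset V)
    (h : Disjoint A B) :
    ((univ.filter fun S : Finset V => (S ∩ A).card = (S ∩ B).card).card : ℝ) ≤
      2 ^ Fintype.card V / Real.sqrt (((A ∪ B).card : ℝ) + 1) := by
  have hcard : (univ.filter fun S : Finset V => (S ∩ A).card = (S ∩ B).card).card ≤
      (A ∪ B).card.choose B.card * 2 ^ (A ∪ B)ᶜ.card := by
    rw [← card_powersetCard, ← card_powerset, ← card_product]
    refine card_le_card_of_injOn (fun S => ((S ∩ A) ∪ (B \ S), S \ (A ∪ B))) ?_ ?_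
    · intro S hS
      simp only [coe_filter, mem_univ, true_and, Set.mem_ofPred_eq] at hS
      simp only [coe_product, Set.mem_prod, mem_coe, mem_powersetCard, mem_powerset]
      refine ⟨⟨?_, ?_⟩, ?_⟩
      · exact union_subset_union inter_subset_right sdiff_subset
      · rw [card_union_of_disjoint (h.mono inter_subset_right sdiff_subset), hS,
          inter_comm, add_comm, card_sdiff_add_card_inter]
      · intro x hx
        simp only [mem_sdiff, mem_compl] at hx ⊢
        exact hx.2
    · intro S _ T _ hST
      obtain ⟨h1, h2⟩ := Prod.mk.inj hST
      ext x
      have h1 := Finset.ext_iff.mp h1 x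
      have h2 := Finset.ext_iff.mp h2 x
      have hd : x ∈ A → x ∉ B := fun ha hb => (disjoint_left.mp h) ha hb
      simp only [mem_union, mem_inter, mem_sdiff] at h1 h2
      tauto
  have hpow : (2 : ℝ) ^ Fintype.card V = 2 ^ (A ∪ B).card * 2 ^ (A ∪ B)ᶜ.card := by
    rw [← pow_add, card_add_card_compl]
  calc ((univ.filter fun S : Finset V => (S ∩ A).card = (S ∩ B).card).card : ℝ)
      ≤ ((A ∪ B).card.choose B.card : ℝ) * 2 ^ (A ∪ B)ᶜ.card := by exact_mod_cast hcard
    _ ≤ 2 ^ (A ∪ B).card / Real.sqrt (((A ∪ B).card : ℝ) + 1) * 2 ^ (A ∪ B)ᶜ.card := by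
        gcongr
        exact choose_le_two_pow_div_sqrt _ _
    _ = 2 ^ Fintype.card V / Real.sqrt (((A ∪ B).card : ℝ) + 1) := by
        rw [hpow]; ring

theorem card_filter_card_inter_eq_le_of_symmDiff {V : Type*} [Fintype V] (A B : Finset V) :
    ((univ.filter fun S : Finset V => (S ∩ A).card = (S ∩ B).card).card : ℝ) ≤
      2 ^ Fintype.card V / Real.sqrt (((symmDiff A B).card : ℝ) + 1) := by
  refine le_trans ?_ (card_filter_card_inter_eq_le (A \ B) (B \ A) disjoint_sdiff_sdiff)
  refine Nat.cast_le.mpr (card_le_card fun S hS => ?_)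
  simp only [mem_filter, mem_univ, true_and] at hS ⊢
  have hA := card_sdiff_add_card_inter (S ∩ A) B
  have hB := card_sdiff_add_card_inter (S ∩ B) A
  rw [inter_right_comm] at hB
  rw [← inter_sdiff_assoc, ← inter_sdiff_assoc]
  omega

/-- A function on `U` with at most `k` values has many pairs with equal values. -/
theorem sq_card_le_mul_card_filter_offDiag {α β : Type*} [DecidableEq β] (U : Finset α) (g : α → β) (k : ℕ)
    (hk : (U.image g).card ≤ k) :
    U.card ^ 2 ≤ k * ((U.offDiag.filter fun p => g p.1 = g p.2).card + U.card) := by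
  have hU : U.card = ∑ b ∈ U.image g, (U.filter fun x => g x = b).card :=
    card_eq_sum_card_image g U
  have hP : (U.offDiag.filter fun p => g p.1 = g p.2).card + U.card =
      ∑ b ∈ U.image g, (U.filter fun x => g x = b).card ^ 2 := by
    have hsplit : ((U ×ˢ U).filter fun p => g p.1 = g p.2).card =
        (U.offDiag.filter fun p => g p.1 = g p.2).card + U.card := by
      rw [← diag_card U, ← diag_union_offDiag, filter_union,
        card_union_of_disjoint (disjoint_filter_filter (disjoint_diag_offDiag U)),
        filter_true_of_mem, add_comm]
      intro p hp
      rw [(mem_diag.mp hp).2]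
    rw [← hsplit, card_eq_sum_card_fiberwise (f := fun p => g p.1) (t := U.image g)]
    · refine sum_congr rfl fun b _ => ?_
      rw [sq, ← card_product]
      congr 1
      ext p
      simp only [mem_filter, mem_product]
      grind
    · intro p hp
      simp only [coe_filter, mem_product, Set.mem_ofPred_eq] at hp
      exact mem_coe.mpr (mem_image_of_mem g hp.1.1)
  rw [hP]
  calc U.card ^ 2 = (∑ b ∈ U.image g, (U.filter fun x => g x = b).card) ^ 2 := by rw [← hU]
    _ ≤ (U.image g).card * ∑ b ∈ U.image g, (U.filter fun x => g x = b).card ^ 2 :=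
        sq_sum_le_card_mul_sum_sq
    _ ≤ k * ∑ b ∈ U.image g, (U.filter fun x => g x = b).card ^ 2 :=
        Nat.mul_le_mul_right _ hk

theorem two_mul_sum_card_inter {V : Type*} [Fintype V] (W : Finset V) :
    2 * ∑ S : Finset V, (S ∩ W).card = 2 ^ Fintype.card V * W.card := by
  have hc : ∑ S : Finset V, (Sᶜ ∩ W).card = ∑ S : Finset V, (S ∩ W).card :=
    Fintype.sum_bijective compl compl_bijective _ _ fun _ => rfl
  have hadd : ∑ S : Finset V, ((S ∩ W).card + (Sᶜ ∩ W).card) =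
      2 ^ Fintype.card V * W.card := by
    rw [← Fintype.card_finset, ← card_univ, ← smul_eq_mul, ← sum_const]
    refine sum_congr rfl fun S _ => ?_
    rw [inter_comm S, add_comm, inter_comm Sᶜ, ← sdiff_eq_inter_compl,
      card_sdiff_add_card_inter]
  rw [sum_add_distrib, hc] at hadd
  omega

theorem distinctDegrees_le_fNumber {V : Type*} [Fintype V] (G : SimpleGraph V)
    (s : Finset V) : distinctDegrees G s ≤ fNumber G := by
  refine le_csSup ⟨Fintype.card V, ?_⟩ ⟨s, rfl⟩
  rintro m ⟨t, rfl⟩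
  exact card_image_le.trans (card_le_univ t)

/-- The number of sets `S` in which `x` and `y` have the same degree. -/
theorem card_filter_degree_eq_le {V : Type*} [Fintype V] (G : SimpleGraph V) (x y : V) :
    ((univ.filter fun S : Finset V => (x ∈ S ∧ y ∈ S) ∧
      (S.filter fun z => G.Adj x z).card = (S.filter fun z => G.Adj y z).card).card : ℝ) ≤
      2 ^ Fintype.card V / Real.sqrt ((nbhdDist G x y : ℝ) + 1) := by
  refine le_trans ?_ (card_filter_card_inter_eq_le_of_symmDiff _ _)
  refine Nat.cast_le.mpr (card_le_card fun S hS => ?_)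
  simp only [mem_filter, mem_univ, true_and] at hS ⊢
  obtain ⟨⟨hx, hy⟩, hS⟩ := hS
  have key : ∀ u v : V, S ∩ (G.neighborFinset u).erase v =
      (S.filter fun z => G.Adj u z).erase v := by
    intro u v
    ext z
    simp only [mem_inter, mem_erase, SimpleGraph.mem_neighborFinset, mem_filter]
    tauto
  rw [key, key, card_erase_eq_ite, card_erase_eq_ite, hS]
  simp only [mem_filter, hx, hy, true_and, G.adj_comm x y]

/-- If `f(G) < k`, then every nonempty vertex subset `W` satisfies
`Σ_{{x,y} ⊆ W} 5/√(δ(x,y)+1) > (|W|² - 3k|W|)/(54k)`.  (Since `δ` is symmetric, the sum over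
unordered pairs equals half the sum over ordered pairs.) -/
theorem stmt_11 {V : Type*} [Fintype V] (k : ℕ) (hk : 0 < k) (G : SimpleGraph V)
    (hf : fNumber G < k) (W : Finset V) (hW : W.Nonempty) :
    (∑ p ∈ W.offDiag, (5 : ℝ) / Real.sqrt ((nbhdDist G p.1 p.2 : ℝ) + 1)) / 2 >
      ((W.card : ℝ) ^ 2 - 3 * (k : ℝ) * (W.card : ℝ)) / (54 * (k : ℝ)) := by
  have hkR : (0 : ℝ) < k := by exact_mod_cast hk
  set N : ℝ := 2 ^ Fintype.card V with hN
  have hNpos : 0 < N := by positivity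
  set w : ℝ := (W.card : ℝ) with hw
  have hwpos : 0 < w := Nat.cast_pos.mpr hW.card_pos
  let g : Finset V → V → ℕ := fun S x => (S.filter fun z => G.Adj x z).card
  let P : Finset V → ℕ := fun S =>
    ((S ∩ W).offDiag.filter fun p => g S p.1 = g S p.2).card
  have hS : ∀ S : Finset V, ((S ∩ W).card : ℝ) ^ 2 ≤ k * ((P S : ℝ) + (S ∩ W).card) := by
    intro S
    have himg : ((S ∩ W).image (g S)).card ≤ k :=
      (card_le_card (image_subset_image inter_subset_left)).trans
        ((distinctDegrees_le_fNumber G S).trans hf.le)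
    have h : (S ∩ W).card ^ 2 ≤ k * (P S + (S ∩ W).card) :=
      sq_card_le_mul_card_filter_offDiag (S ∩ W) (g S) k himg
    exact_mod_cast h
  have hsum : ∑ S : Finset V, ((S ∩ W).card : ℝ) = N * w / 2 := by
    have h : (2 : ℝ) * ∑ S : Finset V, ((S ∩ W).card : ℝ) = N * w := by
      rw [hN, hw]
      exact_mod_cast two_mul_sum_card_inter W
    linarith
  have hsq : N * w ^ 2 / 4 ≤ ∑ S : Finset V, ((S ∩ W).card : ℝ) ^ 2 := by
    have h := sq_sum_le_card_mul_sum_sq (s := (univ : Finset (Finset V)))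
      (f := fun S => ((S ∩ W).card : ℝ))
    rw [hsum, card_univ, Fintype.card_finset, Nat.cast_pow, Nat.cast_ofNat, ← hN] at h
    refine le_of_mul_le_mul_left (le_trans (le_of_eq ?_) h) hNpos
    ring
  have hlow : N * w ^ 2 / 4 ≤ k * (∑ S : Finset V, (P S : ℝ) + N * w / 2) := by
    rw [← hsum, ← sum_add_distrib, mul_sum]
    exact hsq.trans (sum_le_sum fun S _ => hS S)
  set T : ℝ := ∑ p ∈ W.offDiag, 1 / Real.sqrt ((nbhdDist G p.1 p.2 : ℝ) + 1) with hT
  have hup : ∑ S : Finset V, (P S : ℝ) ≤ N * T := by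
    have hPS : ∀ S, P S = (W.offDiag.filter fun p => (p.1 ∈ S ∧ p.2 ∈ S) ∧
        g S p.1 = g S p.2).card := by
      intro S
      refine congrArg card ?_
      ext p
      simp only [mem_filter, mem_offDiag, mem_inter]
      tauto
    have hswap := sum_card_bipartiteAbove_eq_sum_card_bipartiteBelow
      (s := (univ : Finset (Finset V))) (t := W.offDiag)
      (fun S p => (p.1 ∈ S ∧ p.2 ∈ S) ∧ g S p.1 = g S p.2)
    simp only [bipartiteAbove, bipartiteBelow] at hswap
    rw [← Nat.cast_sum, sum_congr rfl fun S _ => hPS S, hswap, Nat.cast_sum, hT, mul_sum]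
    refine sum_le_sum fun p _ => ?_
    rw [mul_one_div]
    exact card_filter_degree_eq_le G p.1 p.2
  have hTnn : 0 ≤ T := sum_nonneg fun p _ => by positivity
  have hLHS : ∑ p ∈ W.offDiag, (5 : ℝ) / Real.sqrt ((nbhdDist G p.1 p.2 : ℝ) + 1) = 5 * T := by
    rw [hT, mul_sum]
    exact sum_congr rfl fun p _ => by rw [mul_one_div]
  have hmain : w ^ 2 / 4 ≤ k * (T + w / 2) := by
    refine le_of_mul_le_mul_left ?_ hNpos
    have := mul_le_mul_of_nonneg_left hup hkR.le
    linarith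
  rw [hLHS, gt_iff_lt, div_lt_iff₀ (by positivity)]
  have hkw : 0 < (k : ℝ) * w := by positivity
  have hkT : 0 ≤ (k : ℝ) * T := by positivity
  linarith
end
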